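/- Let 𝔾 be a connected ribbon graph with a total order ≺ on E(𝔾) and Q ∈ 𝒬_𝔾, let A ⊆ E(Q) and B ⊆ E(𝔾)∖E(Q), and let e ∉ A∪B be an edge that is non-orientable with respect to Q. Then e is neither a bridge nor a plane loop of the ribbon graph 𝔾∖B/A. -/

import Mathlib

/-!
Formalization of ribbon graphs in the flag (graph-encoded-map) presentation:
a finite set of flags with three involutions `s0, s1, s2` such that `s0 ∘ s2 = s2 ∘ s0`
is fixed-point-free, together with a finite set of (labelled) isolated vertices.
Vertices are the orbits of `⟨s1,s2⟩` together with the isolated vertices, edges the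
orbits of `⟨s0,s2⟩`, boundary components the orbits of `⟨s0,s1⟩` together with one per
isolated vertex, and connected components the orbits of `⟨s0,s1,s2⟩` together with the
isolated vertices.  On top of this we define partial duality, deletion, contraction,
quasi-trees and their activities, packaged ribbon graphs, the packaged surface Tutte
polynomial and the generalised Krushkal polynomial.
-/

open scoped Classical

noncomputable section

namespace QTE

/-- A combinatorial ribbon graph: flags with three maps, plus labelled isolated vertices. -/
structure Ribbon (α : Type) where
  flags : Finset α
  s0 : α → α
  s1 : α → α
  s2 : α → α
  isolated : Finset (Finset α)

namespace Ribbon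

variable {α : Type}

/-- One step of any of the maps in `fs`, within the set `F`. -/
def Step (F : Finset α) (fs : List (α → α)) (x y : α) : Prop :=
  x ∈ F ∧ y ∈ F ∧ ∃ s ∈ fs, s x = y

/-- The orbit equivalence relation on `F` generated by the maps in `fs`. -/
def Orb (F : Finset α) (fs : List (α → α)) (x y : α) : Prop :=
  Relation.EqvGen (Step F fs) x y

/-- The orbit of `x` in `F` under the maps `fs`. -/
def orbitOf (F : Finset α) (fs : List (α → α)) (x : α) : Finset α :=
  F.filter (fun y => Orb F fs x y)

/-- All orbits of the maps `fs` on `F`. -/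
def orbits (F : Finset α) (fs : List (α → α)) : Finset (Finset α) :=
  F.image (orbitOf F fs)

variable (G : Ribbon α)

/-- The vertices carrying flags: orbits of `⟨s1,s2⟩`. -/
def vertexOrbits : Finset (Finset α) := orbits G.flags [G.s1, G.s2]

/-- The edges: orbits of `⟨s0,s2⟩`. -/
def edgeSet : Finset (Finset α) := orbits G.flags [G.s0, G.s2]

/-- The boundary components consisting of flags: orbits of `⟨s0,s1⟩`. -/
def boundaryOrbits : Finset (Finset α) := orbits G.flags [G.s0, G.s1]

/-- The connected components carrying flags: orbits of `⟨s0,s1,s2⟩`. -/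
def compOrbits : Finset (Finset α) := orbits G.flags [G.s0, G.s1, G.s2]

/-- The vertex set: vertex orbits together with the isolated vertices. -/
def vertexSet : Finset (Finset α) := G.vertexOrbits ∪ G.isolated

/-- The boundary components: boundary orbits plus one per isolated vertex. -/
def bSet : Finset (Finset α) := G.boundaryOrbits ∪ G.isolated

/-- The connected components: flag components plus the isolated vertices. -/
def compSet : Finset (Finset α) := G.compOrbits ∪ G.isolated

/-- `v(𝔾)`, the number of vertices. -/
def numV : ℕ := G.vertexSet.card
/-- `e(𝔾)`, the number of edges. -/
def numE : ℕ := G.edgeSet.card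
/-- `b(𝔾)`, the number of boundary components. -/
def numB : ℕ := G.bSet.card
/-- `k(𝔾)`, the number of connected components. -/
def numK : ℕ := G.compSet.card

/-- Connectedness of a ribbon graph. -/
def Connected : Prop := G.numK = 1

/-- Euler genus `γ(𝔾) = 2k(𝔾) − v(𝔾) + e(𝔾) − b(𝔾)`. -/
def eulerGenus : ℤ :=
  2 * (G.numK : ℤ) - (G.numV : ℤ) + (G.numE : ℤ) - (G.numB : ℤ)

/-- The axioms making the combinatorial data a genuine ribbon graph:
`s0,s1,s2` are involutions of the flag set (and the identity elsewhere),
`s0` and `s2` commute, and `s0 ∘ s2` is fixed-point-free. -/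
def IsRibbon : Prop :=
  (∀ f ∈ G.flags, G.s0 f ∈ G.flags ∧ G.s1 f ∈ G.flags ∧ G.s2 f ∈ G.flags) ∧
  (∀ f ∈ G.flags, G.s0 (G.s0 f) = f ∧ G.s1 (G.s1 f) = f ∧ G.s2 (G.s2 f) = f) ∧
  (∀ f, f ∉ G.flags → G.s0 f = f ∧ G.s1 f = f ∧ G.s2 f = f) ∧
  (∀ f ∈ G.flags, G.s0 (G.s2 f) = G.s2 (G.s0 f)) ∧
  (∀ f ∈ G.flags, G.s0 (G.s2 f) ≠ f)

/-- The flags lying on the edges of `A`. -/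
def flagsOf (A : Finset (Finset α)) : Finset α := A.biUnion id

/-- The partial dual `𝔾^A`: on the flags of edges of `A` the maps `s0` and `s2`
are interchanged; all other data is unchanged. -/
def partialDual (A : Finset (Finset α)) : Ribbon α where
  flags := G.flags
  s0 := fun f => if f ∈ G.flags then (if f ∈ flagsOf A then G.s2 f else G.s0 f) else f
  s1 := G.s1
  s2 := fun f => if f ∈ G.flags then (if f ∈ flagsOf A then G.s0 f else G.s2 f) else f
  isolated := G.isolated

/-- The geometric dual `𝔾* = 𝔾^{E(𝔾)}`. -/
def dual : Ribbon α := G.partialDual G.edgeSet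

/-- The first iterate of `step` starting from `a` that lies in `keep`. -/
def firstIn (keep : Finset α) (step : α → α) (a : α) : α :=
  if h : ∃ k, step^[k] a ∈ keep then step^[Nat.find h] a else a

/-- Deletion `𝔾 ∖ A` of a set `A` of edges: the flags of the edges of `A` are
removed, `s1` is closed up accordingly (walking on around the vertex past
deleted edge ends), and vertices losing all their flags become isolated
vertices. -/
def delete (A : Finset (Finset α)) : Ribbon α :=
  let keep := G.flags \ flagsOf A
  { flags := keep
    s0 := fun f => if f ∈ keep then G.s0 f else f
    s1 := fun f => if f ∈ keep then firstIn keep (fun g => G.s1 (G.s2 g)) (G.s1 f) else f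
    s2 := fun f => if f ∈ keep then G.s2 f else f
    isolated := G.isolated ∪ G.vertexOrbits.filter (fun v => v ∩ keep = ∅) }

/-- The spanning ribbon subgraph `𝔾|A := 𝔾 ∖ (E(𝔾) ∖ A)`. -/
def restrict (A : Finset (Finset α)) : Ribbon α :=
  G.delete (G.edgeSet \ A)

/-- Contraction `𝔾/A := (𝔾* ∖ A)*`. -/
def contract (A : Finset (Finset α)) : Ribbon α :=
  (G.dual.delete A).dual

/-- An edge is a loop if all its flags lie on a single vertex. -/
def IsLoop (e : Finset α) : Prop :=
  e ∈ G.edgeSet ∧ ∀ f ∈ e, ∀ g ∈ e, Orb G.flags [G.s1, G.s2] f g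

/-- An edge is a bridge if deleting it increases the number of connected components. -/
def IsBridge (e : Finset α) : Prop :=
  e ∈ G.edgeSet ∧ (G.delete {e}).numK > G.numK

/-- A loop is plane if contracting it increases the number of connected components. -/
def IsPlaneLoop (e : Finset α) : Prop :=
  G.IsLoop e ∧ (G.contract {e}).numK > G.numK

/-- A loop is non-orientable if together with its vertex it forms a Möbius band,
i.e. the union of the vertex disc and the edge has a single boundary component. -/
def IsNonorientableLoop (e : Finset α) : Prop :=
  G.IsLoop e ∧
    (((G.restrict {e}).bSet).filter (fun b => ∃ f ∈ b, f ∈ e)).card = 1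

/-- Two loops at the same vertex are interlaced if, travelling around the
boundary of the vertex (the cyclic order of edge ends being given by iterating
`s2 ∘ s1`), their ends are met in the cyclic order `e f e f`: between two
consecutive ends of `e` lies exactly one end of `f`. -/
def Interlaced (e f : Finset α) : Prop :=
  e ≠ f ∧ G.IsLoop e ∧ G.IsLoop f ∧
  (∃ x ∈ e, ∃ y ∈ f, Orb G.flags [G.s1, G.s2] x y) ∧
  ∃ x ∈ e, ∃ m : ℕ, 0 < m ∧ (fun g => G.s2 (G.s1 g))^[m] x ∈ e ∧
    (∀ k, 0 < k → k < m → (fun g => G.s2 (G.s1 g))^[k] x ∉ e) ∧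
    (∃! j, 0 < j ∧ j < m ∧ (fun g => G.s2 (G.s1 g))^[j] x ∈ f)

/-- The quasi-trees of `𝔾`, recorded by their edge sets: the edge sets of the
spanning ribbon subgraphs having exactly one boundary component. -/
def quasiTrees : Finset (Finset (Finset α)) :=
  G.edgeSet.powerset.filter (fun A => (G.restrict A).numB = 1)

/-- `e` links `f` with respect to the quasi-tree with edge set `Q` if `e` and
`f` are interlaced loops in the partial dual `𝔾^{E(Q)}`. -/
def Links (Q : Finset (Finset α)) (e f : Finset α) : Prop :=
  (G.partialDual Q).Interlaced e f

/-- An edge is live w.r.t. `Q` if it links no `lt`-smaller edge; otherwise it is dead. -/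
def Live (lt : Finset α → Finset α → Prop) (Q : Finset (Finset α)) (e : Finset α) : Prop :=
  ∀ f ∈ G.edgeSet, lt f e → ¬ G.Links Q e f

/-- An edge is non-orientable w.r.t. `Q` if it is a non-orientable loop in `𝔾^{E(Q)}`. -/
def NonorientableWrt (Q : Finset (Finset α)) (e : Finset α) : Prop :=
  (G.partialDual Q).IsNonorientableLoop e

/-- `D_Q`: the set of internally dead edges. -/
def DInt (lt : Finset α → Finset α → Prop) (Q : Finset (Finset α)) : Finset (Finset α) :=
  Q.filter (fun e => ¬ G.Live lt Q e)

/-- `D_Q^*`: the set of externally dead edges. -/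
def DExt (lt : Finset α → Finset α → Prop) (Q : Finset (Finset α)) : Finset (Finset α) :=
  (G.edgeSet \ Q).filter (fun e => ¬ G.Live lt Q e)

/-- `O_Q`: the set of internally live orientable edges. -/
def OInt (lt : Finset α → Finset α → Prop) (Q : Finset (Finset α)) : Finset (Finset α) :=
  Q.filter (fun e => G.Live lt Q e ∧ ¬ G.NonorientableWrt Q e)

/-- `O_Q^*`: the set of externally live orientable edges. -/
def OExt (lt : Finset α → Finset α → Prop) (Q : Finset (Finset α)) : Finset (Finset α) :=
  (G.edgeSet \ Q).filter (fun e => G.Live lt Q e ∧ ¬ G.NonorientableWrt Q e)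

/-- `N_Q`: the set of internally live non-orientable edges. -/
def NInt (lt : Finset α → Finset α → Prop) (Q : Finset (Finset α)) : Finset (Finset α) :=
  Q.filter (fun e => G.Live lt Q e ∧ G.NonorientableWrt Q e)

/-- `N_Q^*`: the set of externally live non-orientable edges. -/
def NExt (lt : Finset α → Finset α → Prop) (Q : Finset (Finset α)) : Finset (Finset α) :=
  (G.edgeSet \ Q).filter (fun e => G.Live lt Q e ∧ G.NonorientableWrt Q e)

end Ribbon

variable {α : Type}

/-- Adjacency of two blocks of a partition through an edge in `A`:
the edge has an end (a member of the block, i.e. a vertex or boundary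
component, meeting the edge's flags) in each block. -/
def padj (A : Finset (Finset α)) (B C : Finset (Finset α)) : Prop :=
  ∃ e ∈ A, (∃ v ∈ B, (v ∩ e).Nonempty) ∧ (∃ v ∈ C, (v ∩ e).Nonempty)

/-- The connected components of the packaging `G(𝔾|A;𝒱)`: the multigraph with
vertex set the blocks of `VP` and one edge per edge in `A`. -/
def pcomps (VP : Finset (Finset (Finset α))) (A : Finset (Finset α)) :
    Finset (Finset (Finset (Finset α))) :=
  VP.image (fun B => VP.filter (fun C => Relation.EqvGen (padj A) B C))

/-- The nullity `n = e − v + k` of the packaging `G(𝔾|A;𝒱)`. -/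
def pnull (VP : Finset (Finset (Finset α))) (A : Finset (Finset α)) : ℕ :=
  A.card + (pcomps VP A).card - VP.card

/-- The edges of `A` incident with the set of blocks `K`. -/
def edgesOf (A : Finset (Finset α)) (K : Finset (Finset (Finset α))) : Finset (Finset α) :=
  A.filter (fun e => ∃ B ∈ K, ∃ v ∈ B, (v ∩ e).Nonempty)

/-- `b(𝔾[K])`: the number of boundary components of the ribbon subgraph of `𝔾`
induced by the blocks in `K`, whose edge set is `EK`: the boundary components of
`𝔾|EK` consisting of flags of `EK`, plus one for each vertex lying in a block of
`K` and carrying no flag of an edge of `EK`. -/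
def bInd (G : Ribbon α) (K : Finset (Finset (Finset α))) (EK : Finset (Finset α)) : ℕ :=
  (((G.restrict EK).bSet).filter (fun b => ∃ f ∈ b, f ∈ Ribbon.flagsOf EK)).card +
  ((K.biUnion id).filter (fun v => v ∩ Ribbon.flagsOf EK = ∅)).card

/-- `γ(𝔾,K) = 2k(K) + e(K) − v(K) + ω(K) − b(𝔾[K])` for a set `K` of blocks of a
weighted partition, with incident edge set `EK`. -/
def gammaC (G : Ribbon α) (w : Finset (Finset α) → ℕ)
    (K : Finset (Finset (Finset α))) (EK : Finset (Finset α)) : ℤ :=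
  2 * ((pcomps K EK).card : ℤ) + (EK.card : ℤ) - (K.card : ℤ) +
    (∑ B ∈ K, (w B : ℤ)) - (bInd G K EK : ℤ)

/-- A packaged ribbon graph `𝔾̲ = (𝔾,𝒱,ω_𝒱,ℬ,ω_ℬ)`: a ribbon graph together with
a weighted partition of its vertex set and a weighted partition of its set of
boundary components. -/
structure PRibbon (α : Type) where
  G : Ribbon α
  VP : Finset (Finset (Finset α))
  wV : Finset (Finset α) → ℕ
  BP : Finset (Finset (Finset α))
  wB : Finset (Finset α) → ℕ

/-- `Bl` is a partition of `S`. -/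
def IsPartition {β : Type} (Bl : Finset (Finset β)) (S : Finset β) : Prop :=
  (∀ b ∈ Bl, b.Nonempty) ∧ Bl.biUnion id = S ∧
  (∀ b ∈ Bl, ∀ c ∈ Bl, b ≠ c → Disjoint b c)

/-- The conditions for a packaged ribbon graph to be genuine. -/
def PRibbon.IsPacked (P : PRibbon α) : Prop :=
  P.G.IsRibbon ∧ IsPartition P.VP P.G.vertexSet ∧ IsPartition P.BP P.G.bSet

/-- The packaged surface Tutte polynomial `T(𝔾̲;x,y)`, evaluated in a commutative
ring at values `x`, `y` and `xv i`, `yv i` for the variables `x_i, y_i` (`i ∈ ℤ`):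
`T(𝔾̲;x,y) = ∑_{A⊆E} x^{n(G(𝔾*|Aᶜ;ℬ))} y^{n(G(𝔾|A;𝒱))}
∏_H x_{γ(𝔾*,H)} ∏_K y_{γ(𝔾,K)}`. -/
def pst {R : Type} [CommRing R] (P : PRibbon α) (x y : R) (xv yv : ℤ → R) : R :=
  ∑ A ∈ P.G.edgeSet.powerset,
    x ^ pnull P.BP (P.G.edgeSet \ A) * y ^ pnull P.VP A *
    (∏ H ∈ pcomps P.BP (P.G.edgeSet \ A),
        xv (gammaC P.G.dual P.wB H (edgesOf (P.G.edgeSet \ A) H))) *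
    ∏ K ∈ pcomps P.VP A, yv (gammaC P.G P.wV K (edgesOf A K))

namespace PRibbon

/-- Transport of a block along deletion/contraction: the members of the new
vertex (or boundary component) set contained in a member of the old block. -/
def transport (S : Finset (Finset α)) (Blk : Finset (Finset α)) : Finset (Finset α) :=
  S.filter (fun v' => ∃ v ∈ Blk, v' ⊆ v)

/-- Packaged deletion `𝔾̲ ∖ e`: delete `e` from the ribbon graph, keep the vertex
partition and its weights, and in the boundary partition merge the block(s)
meeting `e` with the newly created boundary component(s): if two distinct blocks
were met, the merged block gets the sum of their weights, and otherwise the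
weight of the old block increases by `1`; all other blocks and weights are
unchanged. -/
def del (P : PRibbon α) (e : Finset α) : PRibbon α :=
  let G' := P.G.delete {e}
  let S := P.G.bSet.filter (fun b => (b ∩ e).Nonempty)
  let Blks := P.BP.filter (fun Blk => ∃ b ∈ Blk, (b ∩ e).Nonempty)
  let merged := (Blks.biUnion id ∪ (G'.bSet \ P.G.bSet)) \ S
  { G := G'
    VP := P.VP.image (transport G'.vertexSet)
    wV := fun B' => ∑ Blk ∈ P.VP.filter (fun Blk => transport G'.vertexSet Blk = B'), P.wV Blk
    BP := (P.BP \ Blks) ∪ {merged}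
    wB := fun B' =>
      if B' = merged then
        (if Blks.card = 2 then ∑ Blk ∈ Blks, P.wB Blk else (∑ Blk ∈ Blks, P.wB Blk) + 1)
      else P.wB B' }

/-- Packaged contraction `𝔾̲ / e`: contract `e` in the ribbon graph, keep the
boundary partition and its weights under the natural correspondence of boundary
components, and in the vertex partition merge the block(s) meeting `e` with the
newly created vertex (or vertices): if two distinct blocks were met, the merged
block gets the sum of their weights, and otherwise the weight of the old block
increases by `1`; all other blocks and weights are unchanged. -/
def con (P : PRibbon α) (e : Finset α) : PRibbon α :=
  let G' := P.G.contract {e}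
  let S := P.G.vertexSet.filter (fun v => (v ∩ e).Nonempty)
  let Blks := P.VP.filter (fun Blk => ∃ v ∈ Blk, (v ∩ e).Nonempty)
  let merged := (Blks.biUnion id ∪ (G'.vertexSet \ P.G.vertexSet)) \ S
  { G := G'
    VP := (P.VP \ Blks) ∪ {merged}
    wV := fun B' =>
      if B' = merged then
        (if Blks.card = 2 then ∑ Blk ∈ Blks, P.wV Blk else (∑ Blk ∈ Blks, P.wV Blk) + 1)
      else P.wV B'
    BP := P.BP.image (transport G'.bSet)
    wB := fun B' => ∑ Blk ∈ P.BP.filter (fun Blk => transport G'.bSet Blk = B'), P.wB Blk }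

/-- Deletion of a set of edges, one edge at a time. -/
def delSet (P : PRibbon α) (A : Finset (Finset α)) : PRibbon α :=
  A.toList.foldl PRibbon.del P

/-- Contraction of a set of edges, one edge at a time. -/
def conSet (P : PRibbon α) (A : Finset (Finset α)) : PRibbon α :=
  A.toList.foldl PRibbon.con P

end PRibbon

/-- The generalised Krushkal polynomial `P(𝔾;α,β,a,b)`, evaluated in a field at
`al = α`, `be = β` and at square roots `sa, sb` of `a, b`
(so that `a^{γ/2} = sa^γ` and `b^{γ/2} = sb^γ`):
`P(𝔾;α,β,a,b) = ∑_{A⊆E} α^{k(𝔾|A)−k(𝔾)} β^{k(𝔾*|Aᶜ)−k(𝔾*)} a^{γ(𝔾|A)/2} b^{γ(𝔾*|Aᶜ)/2}`. -/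
def krushkal {R : Type} [Field R] (G : Ribbon α) (al be sa sb : R) : R :=
  ∑ A ∈ G.edgeSet.powerset,
    al ^ ((G.restrict A).numK - G.numK) *
    be ^ ((G.dual.restrict (G.edgeSet \ A)).numK - G.dual.numK) *
    sa ^ (G.restrict A).eulerGenus *
    sb ^ (G.dual.restrict (G.edgeSet \ A)).eulerGenus

/-- Adjacency of two vertices of an abstract multigraph through an edge of `E`,
for a given incidence relation. -/
def relAdj {β ε : Type} (E : Finset ε) (inc : β → ε → Prop) (u v : β) : Prop :=
  ∃ e ∈ E, inc u e ∧ inc v e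

/-- The number `k(G|A)` of connected components of the spanning subgraph with
edge set `A` of the multigraph with vertex set `V` and incidence relation `inc`. -/
def kRel {β ε : Type} (V : Finset β) (A : Finset ε) (inc : β → ε → Prop) : ℕ :=
  (V.image (fun u => V.filter (fun v => Relation.EqvGen (relAdj A inc) u v))).card

/-- The Tutte polynomial `T(G;x,y) = ∑_{A⊆E} (x−1)^{k(G|A)−k(G)} (y−1)^{n(G|A)}`
of the multigraph with vertex set `V`, edge set `E` and incidence relation
`inc`, where `n(G|A) = |A| − v(G) + k(G|A)`. -/
def tutteRel {β ε : Type} {R : Type} [CommRing R]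
    (V : Finset β) (E : Finset ε) (inc : β → ε → Prop) (x y : R) : R :=
  ∑ A ∈ E.powerset,
    (x - 1) ^ (kRel V A inc - kRel V E inc) * (y - 1) ^ (A.card + kRel V A inc - V.card)

/-- Incidence between a connected component `u` of a ribbon subgraph of `G`
(or an isolated-vertex label) and an edge `e` of `G`: `e` has a flag lying on a
vertex of `G` meeting `u`. -/
def incCompG (G : Ribbon α) (u e : Finset α) : Prop :=
  ∃ f ∈ e, ∃ g ∈ u, Ribbon.Orb G.flags [G.s1, G.s2] f g

end QTE

namespace QTE

namespace Ribbon

section Orbits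

variable {α : Type} {F S : Finset α} {fs gs : List (α → α)} {x y z : α}

theorem Orb.equivalence : Equivalence (Orb F fs) := Relation.EqvGen.is_equivalence _

theorem Orb.refl (x : α) : Orb F fs x x := Orb.equivalence.refl x

theorem Orb.symm (h : Orb F fs x y) : Orb F fs y x := Orb.equivalence.symm h

theorem Orb.trans (h : Orb F fs x y) (h' : Orb F fs y z) : Orb F fs x z :=
  Orb.equivalence.trans h h'

theorem Orb.of_map {s : α → α} (hs : s ∈ fs) (hx : x ∈ F) (hsx : s x ∈ F) :
    Orb F fs x (s x) :=
  Relation.EqvGen.rel _ _ ⟨hx, hsx, s, hs, rfl⟩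

/-- The orbit relation is contained in every equivalence relation containing the steps. -/
theorem Orb.lift {r : α → α → Prop} (hr : Equivalence r)
    (h : ∀ s ∈ fs, ∀ a ∈ F, s a ∈ F → r a (s a)) (hxy : Orb F fs x y) : r x y := by
  induction hxy with
  | rel a b hab =>
    obtain ⟨ha, hb, s, hs, rfl⟩ := hab
    exact h s hs a ha hb
  | refl a => exact hr.refl a
  | symm a b _ ih => exact hr.symm ih
  | trans a b c _ _ h₁ h₂ => exact hr.trans h₁ h₂

theorem Orb.iff_of_step {p : α → Prop}
    (h : ∀ s ∈ fs, ∀ a ∈ F, s a ∈ F → (p a ↔ p (s a))) (hxy : Orb F fs x y) :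
    p x ↔ p y :=
  Orb.lift (r := fun a b => p a ↔ p b)
    ⟨fun _ => Iff.rfl, fun h => h.symm, fun h h' => h.trans h'⟩ h hxy

theorem mem_orbitOf : y ∈ orbitOf F fs x ↔ y ∈ F ∧ Orb F fs x y := by
  simp [orbitOf]

theorem self_mem_orbitOf (hx : x ∈ F) : x ∈ orbitOf F fs x :=
  mem_orbitOf.2 ⟨hx, Orb.refl x⟩

theorem orbitOf_mem_orbits (hx : x ∈ F) : orbitOf F fs x ∈ orbits F fs :=
  Finset.mem_image_of_mem _ hx

theorem mem_orbits {O : Finset α} : O ∈ orbits F fs ↔ ∃ a ∈ F, orbitOf F fs a = O := by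
  simp [orbits]

theorem subset_of_mem_orbits {O : Finset α} (hO : O ∈ orbits F fs) : O ⊆ F := by
  obtain ⟨a, -, rfl⟩ := mem_orbits.1 hO
  exact fun b hb => (mem_orbitOf.1 hb).1

theorem orbitOf_eq_of_mem {O : Finset α} (hO : O ∈ orbits F fs) (hx : x ∈ O) :
    orbitOf F fs x = O := by
  obtain ⟨a, -, rfl⟩ := mem_orbits.1 hO
  have hax := (mem_orbitOf.1 hx).2
  ext b
  rw [mem_orbitOf, mem_orbitOf]
  exact and_congr_right fun _ => ⟨hax.trans, hax.symm.trans⟩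

/-- The maps `fs` act transitively on `F`. -/
def OrbTransitive (F : Finset α) (fs : List (α → α)) : Prop :=
  ∀ x ∈ F, ∀ y ∈ F, Orb F fs x y

theorem OrbTransitive.of_step (h : OrbTransitive F fs)
    (hs : ∀ s ∈ fs, ∀ a ∈ F, s a ∈ F → Orb F gs a (s a)) : OrbTransitive F gs :=
  fun x hx y hy => Orb.lift Orb.equivalence hs (h x hx y hy)

theorem OrbTransitive.orbitOf_eq (h : OrbTransitive F fs) (hx : x ∈ F) :
    orbitOf F fs x = F := by
  ext b
  rw [mem_orbitOf]
  exact ⟨fun hb => hb.1, fun hb => ⟨hb, h x hx b hb⟩⟩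

theorem OrbTransitive.orbits_subset (h : OrbTransitive F fs) : orbits F fs ⊆ {F} := by
  intro O hO
  obtain ⟨a, ha, rfl⟩ := mem_orbits.1 hO
  exact Finset.mem_singleton.2 (h.orbitOf_eq ha)

/-- If `t` agrees with `u` outside a `u`-invariant set `S`, then every orbit of `s, u`
meeting `S` can be followed up to its first visit to `S` using `s` and `t` only. -/
theorem Orb.exists_mem_of_eq_off {s u t : α → α} (hS : ∀ a, u a ∈ S ↔ a ∈ S)
    (hut : ∀ a ∈ F, a ∉ S → t a = u a) (hxy : Orb F [s, u] x y) (hy : y ∈ S) :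
    ∃ b ∈ S, Orb F [s, t] x b := by
  refine (Orb.iff_of_step (p := fun a => ∃ b ∈ S, Orb F [s, t] a b) ?_ hxy).2
    ⟨y, hy, Orb.refl y⟩
  have key : ∀ a c, Orb F [s, t] a c →
      ((∃ b ∈ S, Orb F [s, t] a b) ↔ ∃ b ∈ S, Orb F [s, t] c b) := fun a c hac =>
    ⟨fun ⟨b, hb, h⟩ => ⟨b, hb, hac.symm.trans h⟩, fun ⟨b, hb, h⟩ => ⟨b, hb, hac.trans h⟩⟩
  intro r hr a ha hra
  rcases List.mem_pair.1 hr with rfl | rfl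
  · exact key _ _ (Orb.of_map (by simp) ha hra)
  · by_cases haS : a ∈ S
    · exact ⟨fun _ => ⟨_, (hS a).2 haS, Orb.refl _⟩, fun _ => ⟨a, haS, Orb.refl a⟩⟩
    · rw [← hut a ha haS] at hra ⊢
      exact key _ _ (Orb.of_map (by simp) ha hra)

end Orbits

section Walks

variable {α : Type} {K : Finset α} {f : α → α} {a : α}

/-- The forward orbit of `a` under `f` visits `K`. -/
def Reaches (K : Finset α) (f : α → α) (a : α) : Prop := ∃ k, f^[k] a ∈ K

theorem Reaches.of_mem (h : a ∈ K) : Reaches K f a := ⟨0, h⟩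

theorem Reaches.of_step (h : Reaches K f (f a)) : Reaches K f a := by
  obtain ⟨k, hk⟩ := h
  exact ⟨k + 1, hk⟩

theorem Reaches.step (h : Reaches K f a) (ha : a ∉ K) : Reaches K f (f a) := by
  obtain ⟨_ | k, hk⟩ := h
  · exact absurd hk ha
  · exact ⟨k, hk⟩

theorem Reaches.induction {p : α → Prop} (base : ∀ a ∈ K, p a)
    (step : ∀ a, a ∉ K → Reaches K f (f a) → p (f a) → p a) (h : Reaches K f a) : p a := by
  obtain ⟨k, hk⟩ := h
  induction k generalizing a with
  | zero => exact base a hk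
  | succ k ih =>
    by_cases ha : a ∈ K
    · exact base a ha
    · exact step a ha ⟨k, hk⟩ (ih hk)

theorem firstIn_mem (h : Reaches K f a) : firstIn K f a ∈ K := by
  have h' : ∃ k, f^[k] a ∈ K := h
  rw [firstIn, dif_pos h']
  exact Nat.find_spec h'

theorem firstIn_of_mem (h : a ∈ K) : firstIn K f a = a := by
  have h' : ∃ k, f^[k] a ∈ K := ⟨0, h⟩
  rw [firstIn, dif_pos h', (Nat.find_eq_zero h').2 h]
  rfl

theorem firstIn_of_not_mem (ha : a ∉ K) (h : Reaches K f (f a)) :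
    firstIn K f a = firstIn K f (f a) := by
  have h₂ : ∃ k, f^[k] (f a) ∈ K := h
  have h₁ : ∃ k, f^[k] a ∈ K := h.of_step
  rw [firstIn, firstIn, dif_pos h₁, dif_pos h₂, Nat.find_comp_succ h₁ h₂ ha]
  rfl

theorem firstIn_of_not_reaches (h : ¬ Reaches K f a) : firstIn K f a = a := dif_neg h

theorem exists_iterate_succ_eq {F : Finset α} (hf : Function.Injective f)
    (hF : ∀ a ∈ F, f a ∈ F) (ha : a ∈ F) : ∃ n, f^[n + 1] a = a := by
  have hmem : ∀ n, f^[n] a ∈ F := fun n => by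
    induction n with
    | zero => exact ha
    | succ n ih => rw [Function.iterate_succ_apply']; exact hF _ ih
  obtain ⟨i, j, hij, h⟩ :=
    Finite.exists_ne_map_eq_of_infinite (fun n : ℕ => (⟨f^[n] a, hmem n⟩ : F))
  replace h : f^[i] a = f^[j] a := congrArg Subtype.val h
  wlog hlt : i < j generalizing i j
  · exact this j i hij.symm h.symm (by omega)
  obtain ⟨n, rfl⟩ : ∃ n, j = i + (n + 1) := ⟨j - i - 1, by omega⟩
  rw [Function.iterate_add_apply] at h
  exact ⟨n, (hf.iterate i h).symm⟩

variable {s u : α → α}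

theorem reaches_of_mem {F : Finset α} (hs : Function.Involutive s) (hu : Function.Involutive u)
    (hsF : ∀ a ∈ F, s a ∈ F) (huF : ∀ a ∈ F, u a ∈ F) (hKF : K ⊆ F)
    (hK : ∀ a, u a ∈ K ↔ a ∈ K) (ha : a ∈ K) :
    Reaches K (fun g => s (u g)) (s a) := by
  obtain ⟨n, hn⟩ := exists_iterate_succ_eq (f := fun g => s (u g)) (a := u a)
    (hs.injective.comp hu.injective) (fun a ha => hsF _ (huF _ ha)) (huF _ (hKF ha))
  refine ⟨n, ?_⟩
  rw [Function.iterate_succ_apply, hu a] at hn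
  rw [hn]
  exact (hK a).2 ha

/-- Walking around a vertex in the two possible directions from a flag ends in the two
ends of the same excursion. -/
theorem Reaches.firstIn_map {F : Finset α} (hs : Function.Involutive s)
    (hu : Function.Involutive u) (hsF : ∀ a ∈ F, s a ∈ F) (huF : ∀ a ∈ F, u a ∈ F)
    (hKF : K ⊆ F) (hK : ∀ a, u a ∈ K ↔ a ∈ K) (h : Reaches K (fun g => s (u g)) a) :
    Reaches K (fun g => s (u g)) (s a) ∧
      firstIn K (fun g => s (u g)) (s a) =
        firstIn K (fun g => s (u g)) (s (firstIn K (fun g => s (u g)) a)) := by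
  refine Reaches.induction (p := fun a => Reaches K (fun g => s (u g)) (s a) ∧
      firstIn K (fun g => s (u g)) (s a) =
        firstIn K (fun g => s (u g)) (s (firstIn K (fun g => s (u g)) a))) ?_ ?_ h
  · intro a ha
    exact ⟨reaches_of_mem hs hu hsF huF hKF hK ha, by rw [firstIn_of_mem ha]⟩
  · intro a ha hr ⟨hr', he⟩
    rw [hs (u a)] at hr' he
    have hua : u a ∉ K := fun h => ha ((hK a).1 h)
    have hr'' := hr'.step hua
    have he' := firstIn_of_not_mem hua hr''
    simp only [hu a] at hr'' he'
    refine ⟨hr'', ?_⟩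
    rw [← he', he, firstIn_of_not_mem ha hr]

end Walks

section Ribbons

variable {α : Type} {G : Ribbon α} {A B Q : Finset (Finset α)} {x y : α}

theorem IsRibbon.s0_involutive (hG : G.IsRibbon) : Function.Involutive G.s0 := fun x => by
  by_cases hx : x ∈ G.flags
  · exact (hG.2.1 x hx).1
  · rw [(hG.2.2.1 x hx).1, (hG.2.2.1 x hx).1]

theorem IsRibbon.s1_involutive (hG : G.IsRibbon) : Function.Involutive G.s1 := fun x => by
  by_cases hx : x ∈ G.flags
  · exact (hG.2.1 x hx).2.1
  · rw [(hG.2.2.1 x hx).2.1, (hG.2.2.1 x hx).2.1]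

theorem IsRibbon.s2_involutive (hG : G.IsRibbon) : Function.Involutive G.s2 := fun x => by
  by_cases hx : x ∈ G.flags
  · exact (hG.2.1 x hx).2.2
  · rw [(hG.2.2.1 x hx).2.2, (hG.2.2.1 x hx).2.2]

/-- The set `S` of flags is a union of edges. -/
def EdgeClosed (G : Ribbon α) (S : Finset α) : Prop :=
  (∀ x, G.s0 x ∈ S ↔ x ∈ S) ∧ ∀ x, G.s2 x ∈ S ↔ x ∈ S

theorem IsRibbon.edgeClosed_flags (hG : G.IsRibbon) : G.EdgeClosed G.flags := by
  refine ⟨fun x => ⟨fun h => ?_, fun h => (hG.1 x h).1⟩,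
    fun x => ⟨fun h => ?_, fun h => (hG.1 x h).2.2⟩⟩
  · rw [← hG.s0_involutive x]; exact (hG.1 _ h).1
  · rw [← hG.s2_involutive x]; exact (hG.1 _ h).2.2

theorem EdgeClosed.sdiff {S T : Finset α} (hS : G.EdgeClosed S) (hT : G.EdgeClosed T) :
    G.EdgeClosed (S \ T) := by
  refine ⟨fun x => ?_, fun x => ?_⟩
  · rw [Finset.mem_sdiff, Finset.mem_sdiff, hS.1, hT.1]
  · rw [Finset.mem_sdiff, Finset.mem_sdiff, hS.2, hT.2]

theorem mem_flagsOf : x ∈ flagsOf A ↔ ∃ e ∈ A, x ∈ e := by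
  simp [flagsOf]

theorem flagsOf_singleton (e : Finset α) : flagsOf {e} = e := by
  simp [flagsOf]

theorem IsRibbon.edgeClosed_flagsOf (hG : G.IsRibbon) (hA : A ⊆ G.edgeSet) :
    G.EdgeClosed (flagsOf A) := by
  have key : ∀ s ∈ [G.s0, G.s2], (∀ a ∈ G.flags, s a ∈ G.flags) →
      ∀ x ∈ flagsOf A, s x ∈ flagsOf A := by
    intro s hs hsF x hx
    obtain ⟨e, he, hxe⟩ := mem_flagsOf.1 hx
    have hxF := subset_of_mem_orbits (hA he) hxe
    refine mem_flagsOf.2 ⟨e, he, ?_⟩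
    rw [← orbitOf_eq_of_mem (hA he) hxe, mem_orbitOf]
    exact ⟨hsF x hxF, Orb.of_map hs hxF (hsF x hxF)⟩
  have k0 := key G.s0 (by simp) fun a ha => (hG.1 a ha).1
  have k2 := key G.s2 (by simp) fun a ha => (hG.1 a ha).2.2
  refine ⟨fun x => ⟨fun h => ?_, k0 x⟩, fun x => ⟨fun h => ?_, k2 x⟩⟩
  · rw [← hG.s0_involutive x]; exact k0 _ h
  · rw [← hG.s2_involutive x]; exact k2 _ h

theorem flagsOf_edgeSet : flagsOf G.edgeSet = G.flags := by
  ext x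
  rw [mem_flagsOf]
  exact ⟨fun ⟨e, he, hx⟩ => subset_of_mem_orbits he hx,
    fun hx => ⟨_, orbitOf_mem_orbits hx, self_mem_orbitOf hx⟩⟩

theorem mem_flagsOf_edgeSet_sdiff (hQ : Q ⊆ G.edgeSet) :
    x ∈ flagsOf (G.edgeSet \ Q) ↔ x ∈ G.flags ∧ x ∉ flagsOf Q := by
  constructor
  · intro h
    obtain ⟨e, he, hxe⟩ := mem_flagsOf.1 h
    rw [Finset.mem_sdiff] at he
    refine ⟨subset_of_mem_orbits he.1 hxe, fun h' => ?_⟩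
    obtain ⟨e', he', hxe'⟩ := mem_flagsOf.1 h'
    rw [← orbitOf_eq_of_mem he.1 hxe, orbitOf_eq_of_mem (hQ he') hxe'] at he
    exact he.2 he'
  · rintro ⟨hx, hxQ⟩
    rw [← flagsOf_edgeSet] at hx
    obtain ⟨e, he, hxe⟩ := mem_flagsOf.1 hx
    exact mem_flagsOf.2 ⟨e, Finset.mem_sdiff.2 ⟨he, fun h => hxQ (mem_flagsOf.2 ⟨e, h, hxe⟩)⟩, hxe⟩

theorem mem_flags_restrict (hQ : Q ⊆ G.edgeSet) :
    x ∈ (G.restrict Q).flags ↔ x ∈ flagsOf Q := by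
  change x ∈ G.flags \ _ ↔ _
  rw [Finset.mem_sdiff, mem_flagsOf_edgeSet_sdiff hQ]
  have : x ∈ flagsOf Q → x ∈ G.flags := fun h => by
    obtain ⟨e, he, hxe⟩ := mem_flagsOf.1 h
    exact subset_of_mem_orbits (hQ he) hxe
  tauto

theorem IsRibbon.partialDual_s0 (hG : G.IsRibbon) (x : α) :
    (G.partialDual Q).s0 x = if x ∈ flagsOf Q then G.s2 x else G.s0 x := by
  by_cases hx : x ∈ G.flags
  · exact if_pos hx
  · simp [Ribbon.partialDual, hx, hG.2.2.1 x hx]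

theorem IsRibbon.partialDual_s2 (hG : G.IsRibbon) (x : α) :
    (G.partialDual Q).s2 x = if x ∈ flagsOf Q then G.s0 x else G.s2 x := by
  by_cases hx : x ∈ G.flags
  · exact if_pos hx
  · simp [Ribbon.partialDual, hx, hG.2.2.1 x hx]

theorem IsRibbon.partialDual (hG : G.IsRibbon) (hQ : G.EdgeClosed (flagsOf Q)) :
    (G.partialDual Q).IsRibbon := by
  have hf : (G.partialDual Q).flags = G.flags := rfl
  have h1 : (G.partialDual Q).s1 = G.s1 := rfl
  unfold IsRibbon
  simp only [hf, h1, hG.partialDual_s0, hG.partialDual_s2]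
  refine ⟨fun f hf => ?_, fun f hf => ?_, fun f hf => ?_, fun f hf => ?_, fun f hf => ?_⟩ <;>
    by_cases hfQ : f ∈ flagsOf Q
  · simpa [hfQ] using ⟨(hG.1 f hf).2.2, (hG.1 f hf).2.1, (hG.1 f hf).1⟩
  · simpa [hfQ] using hG.1 f hf
  · simpa [hfQ, hQ.1, hQ.2] using ⟨(hG.2.1 f hf).2.2, (hG.2.1 f hf).2.1, (hG.2.1 f hf).1⟩
  · simpa [hfQ, hQ.1, hQ.2] using hG.2.1 f hf
  · simp [hG.2.2.1 f hf]
  · simp [hG.2.2.1 f hf]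
  · simpa [hfQ, hQ.1, hQ.2] using (hG.2.2.2.1 f hf).symm
  · simpa [hfQ, hQ.1, hQ.2] using hG.2.2.2.1 f hf
  · simpa [hfQ, hQ.1, ← hG.2.2.2.1 f hf] using hG.2.2.2.2 f hf
  · simpa [hfQ, hQ.2] using hG.2.2.2.2 f hf

/-- The ribbon graph with the roles of `s0` and `s2` exchanged. -/
def swap (G : Ribbon α) : Ribbon α := ⟨G.flags, G.s2, G.s1, G.s0, G.isolated⟩

theorem IsRibbon.swap (hG : G.IsRibbon) : G.swap.IsRibbon :=
  ⟨fun f hf => ⟨(hG.1 f hf).2.2, (hG.1 f hf).2.1, (hG.1 f hf).1⟩,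
    fun f hf => ⟨(hG.2.1 f hf).2.2, (hG.2.1 f hf).2.1, (hG.2.1 f hf).1⟩,
    fun f hf => ⟨(hG.2.2.1 f hf).2.2, (hG.2.2.1 f hf).2.1, (hG.2.2.1 f hf).1⟩,
    fun f hf => (hG.2.2.2.1 f hf).symm,
    fun f hf h => hG.2.2.2.2 f hf ((hG.2.2.2.1 f hf).trans h)⟩

theorem IsRibbon.dual_eq_swap (hG : G.IsRibbon) : G.dual = G.swap := by
  unfold dual Ribbon.partialDual Ribbon.swap
  rw [flagsOf_edgeSet]
  congr 1 <;> funext x <;> by_cases hx : x ∈ G.flags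
  · simp [hx]
  · simp [hx, (hG.2.2.1 x hx).2.2]
  · simp [hx]
  · simp [hx, (hG.2.2.1 x hx).1]

theorem numK_swap : G.swap.numK = G.numK := by
  have h : ∀ x y, Orb G.flags [G.s2, G.s1, G.s0] x y ↔ Orb G.flags [G.s0, G.s1, G.s2] x y := by
    intro x y
    constructor <;> refine Orb.lift Orb.equivalence fun s hs a ha hsa => Orb.of_map ?_ ha hsa <;>
      simp only [List.mem_cons, List.not_mem_nil, or_false] at hs ⊢ <;> tauto
  have : G.swap.compSet = G.compSet := by
    have h' : orbitOf G.flags [G.s2, G.s1, G.s0] = orbitOf G.flags [G.s0, G.s1, G.s2] := by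
      funext x
      simp only [orbitOf, h]
    simp only [compSet, compOrbits, orbits, swap, h']
  rw [numK, this, numK]

theorem EdgeClosed.swap {S : Finset α} (hS : G.EdgeClosed S) : G.swap.EdgeClosed S :=
  ⟨hS.2, hS.1⟩

theorem EdgeClosed.delete {S : Finset α} (hS : G.EdgeClosed S) (A : Finset (Finset α)) :
    (G.delete A).EdgeClosed S := by
  refine ⟨fun x => ?_, fun x => ?_⟩ <;> by_cases hx : x ∈ G.flags \ flagsOf A
  · rw [show (G.delete A).s0 x = G.s0 x from if_pos hx, hS.1]
  · rw [show (G.delete A).s0 x = x from if_neg hx]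
  · rw [show (G.delete A).s2 x = G.s2 x from if_pos hx, hS.2]
  · rw [show (G.delete A).s2 x = x from if_neg hx]

theorem delete_s0 (hx : x ∈ G.flags \ flagsOf A) : (G.delete A).s0 x = G.s0 x := if_pos hx

theorem delete_s1 (hx : x ∈ G.flags \ flagsOf A) :
    (G.delete A).s1 x =
      firstIn (G.flags \ flagsOf A) (fun g => G.s1 (G.s2 g)) (G.s1 x) := if_pos hx

theorem delete_s2 (hx : x ∈ G.flags \ flagsOf A) : (G.delete A).s2 x = G.s2 x := if_pos hx

theorem IsRibbon.firstIn_s1 (hG : G.IsRibbon) (hA : G.EdgeClosed (flagsOf A))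
    (h : Reaches (G.flags \ flagsOf A) (fun g => G.s1 (G.s2 g)) x) :
    Reaches (G.flags \ flagsOf A) (fun g => G.s1 (G.s2 g)) (G.s1 x) ∧
      firstIn (G.flags \ flagsOf A) (fun g => G.s1 (G.s2 g)) (G.s1 x) =
        (G.delete A).s1 (firstIn (G.flags \ flagsOf A) (fun g => G.s1 (G.s2 g)) x) := by
  rw [delete_s1 (firstIn_mem h)]
  exact h.firstIn_map hG.s1_involutive hG.s2_involutive (fun a ha => (hG.1 a ha).2.1)
    (fun a ha => (hG.1 a ha).2.2) Finset.sdiff_subset (hG.edgeClosed_flags.sdiff hA).2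

theorem IsRibbon.delete (hG : G.IsRibbon) (hA : G.EdgeClosed (flagsOf A)) :
    (G.delete A).IsRibbon := by
  have hK := hG.edgeClosed_flags.sdiff hA
  have hf : (G.delete A).flags = G.flags \ flagsOf A := rfl
  have hs1 : ∀ f ∈ G.flags \ flagsOf A, (G.delete A).s1 f ∈ G.flags \ flagsOf A := by
    intro f hf
    rw [delete_s1 hf]
    exact firstIn_mem (hG.firstIn_s1 hA (.of_mem hf)).1
  unfold IsRibbon
  simp only [hf]
  refine ⟨fun f hf => ?_, fun f hf => ?_, fun f hf => ?_, fun f hf => ?_, fun f hf => ?_⟩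
  · rw [delete_s0 hf, delete_s2 hf]
    exact ⟨(hK.1 f).2 hf, hs1 f hf, (hK.2 f).2 hf⟩
  · rw [delete_s0 hf, delete_s2 hf, delete_s0 ((hK.1 f).2 hf), delete_s2 ((hK.2 f).2 hf)]
    refine ⟨hG.s0_involutive f, ?_, hG.s2_involutive f⟩
    rw [delete_s1 hf, ← (hG.firstIn_s1 hA (hG.firstIn_s1 hA (.of_mem hf)).1).2,
      hG.s1_involutive f, firstIn_of_mem hf]
  · exact ⟨if_neg hf, if_neg hf, if_neg hf⟩
  · rw [delete_s0 hf, delete_s2 hf, delete_s0 ((hK.2 f).2 hf), delete_s2 ((hK.1 f).2 hf)]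
    exact hG.2.2.2.1 f (Finset.sdiff_subset hf)
  · rw [delete_s2 hf, delete_s0 ((hK.2 f).2 hf)]
    exact hG.2.2.2.2 f (Finset.sdiff_subset hf)

/-- Deleting edges whose flags are moved by `t` as by `s2` preserves transitivity of
`s1` and `t`. -/
theorem IsRibbon.orbTransitive_delete (hG : G.IsRibbon) (hA : G.EdgeClosed (flagsOf A))
    {t : α → α} (ht : ∀ a ∈ G.flags, t a = G.s0 a ∨ t a = G.s2 a)
    (hts : ∀ a ∈ G.flags, a ∈ flagsOf A → t a = G.s2 a)
    (h : OrbTransitive G.flags [G.s1, t]) :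
    OrbTransitive (G.delete A).flags [(G.delete A).s1, t] := by
  have hK := hG.edgeClosed_flags.sdiff hA
  have hsub : G.flags \ flagsOf A ⊆ G.flags := Finset.sdiff_subset
  have htK : ∀ a ∈ G.flags \ flagsOf A, t a ∈ G.flags \ flagsOf A := fun a ha => by
    rcases ht a (hsub ha) with h | h <;> rw [h]
    exacts [(hK.1 a).2 ha, (hK.2 a).2 ha]
  have hw : ∀ {a}, _ → _ := fun {a} => hG.firstIn_s1 (x := a) hA
  change OrbTransitive (G.flags \ flagsOf A) _
  have key : ∀ a b, Orb G.flags [G.s1, t] a b →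
      (Reaches (G.flags \ flagsOf A) (fun g => G.s1 (G.s2 g)) a ↔
        Reaches (G.flags \ flagsOf A) (fun g => G.s1 (G.s2 g)) b) ∧
      (Reaches (G.flags \ flagsOf A) (fun g => G.s1 (G.s2 g)) a →
        Orb (G.flags \ flagsOf A) [(G.delete A).s1, t]
          (firstIn (G.flags \ flagsOf A) (fun g => G.s1 (G.s2 g)) a)
          (firstIn (G.flags \ flagsOf A) (fun g => G.s1 (G.s2 g)) b)) := by
    have hs1 : ∀ a, Reaches (G.flags \ flagsOf A) (fun g => G.s1 (G.s2 g)) a →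
        Orb (G.flags \ flagsOf A) [(G.delete A).s1, t]
          (firstIn (G.flags \ flagsOf A) (fun g => G.s1 (G.s2 g)) a)
          (firstIn (G.flags \ flagsOf A) (fun g => G.s1 (G.s2 g)) (G.s1 a)) := by
      intro a ha
      have hmem := firstIn_mem (hw ha).1
      rw [(hw ha).2] at hmem ⊢
      exact Orb.of_map (by simp) (firstIn_mem ha) hmem
    intro a b hab
    refine Orb.lift (r := fun a b =>
      (Reaches (G.flags \ flagsOf A) (fun g => G.s1 (G.s2 g)) a ↔
        Reaches (G.flags \ flagsOf A) (fun g => G.s1 (G.s2 g)) b) ∧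
      (Reaches (G.flags \ flagsOf A) (fun g => G.s1 (G.s2 g)) a →
        Orb (G.flags \ flagsOf A) [(G.delete A).s1, t]
          (firstIn (G.flags \ flagsOf A) (fun g => G.s1 (G.s2 g)) a)
          (firstIn (G.flags \ flagsOf A) (fun g => G.s1 (G.s2 g)) b)))
      ⟨fun a => ⟨Iff.rfl, fun _ => Orb.refl _⟩,
        fun h => ⟨h.1.symm, fun hb => (h.2 (h.1.2 hb)).symm⟩,
        fun h h' => ⟨h.1.trans h'.1, fun ha => (h.2 ha).trans (h'.2 (h.1.1 ha))⟩⟩ ?_ hab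
    intro s hs c hc hsc
    rcases List.mem_pair.1 hs with rfl | rfl
    · refine ⟨⟨fun h => (hw h).1, fun h => ?_⟩, hs1 c⟩
      rw [← hG.s1_involutive c]
      exact (hw h).1
    · by_cases hcK : c ∈ G.flags \ flagsOf A
      · refine ⟨⟨fun _ => .of_mem (htK c hcK), fun _ => .of_mem hcK⟩, fun _ => ?_⟩
        rw [firstIn_of_mem hcK, firstIn_of_mem (htK c hcK)]
        exact Orb.of_map (by simp) hcK (htK c hcK)
      · have hcA : c ∈ flagsOf A := by
          by_contra h
          exact hcK (Finset.mem_sdiff.2 ⟨hc, h⟩)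
        rw [hts c hc hcA]
        have hcK' : G.s2 c ∉ G.flags \ flagsOf A := fun h => hcK ((hK.2 c).1 h)
        have hstep : G.s1 (G.s2 (G.s2 c)) = G.s1 c := by rw [hG.s2_involutive c]
        have hfwd : Reaches (G.flags \ flagsOf A) (fun g => G.s1 (G.s2 g)) c →
            Reaches (G.flags \ flagsOf A) (fun g => G.s1 (G.s2 g))
              (G.s1 (G.s2 (G.s2 c))) := fun h => by rw [hstep]; exact (hw h).1
        refine ⟨⟨fun h => Reaches.of_step (hfwd h), fun h => ?_⟩, fun h => ?_⟩
        · have := (hw (h.step hcK')).1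
          simpa only [hstep, hG.s1_involutive c] using this
        · rw [firstIn_of_not_mem hcK' (hfwd h)]
          simp only [hstep]
          exact hs1 c h
  intro a ha b hb
  have := (key a b (h a (hsub ha) b (hsub hb))).2 (.of_mem ha)
  rwa [firstIn_of_mem ha, firstIn_of_mem hb] at this

theorem IsRibbon.orb_of_orb_delete (hG : G.IsRibbon)
    {t : α → α} (hts : ∀ a ∈ G.flags, a ∈ flagsOf A → t a = G.s2 a)
    (h : Orb (G.delete A).flags [(G.delete A).s1, t] x y) : Orb G.flags [G.s1, t] x y := by
  have hsub : G.flags \ flagsOf A ⊆ G.flags := Finset.sdiff_subset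
  have hwalk : ∀ a, a ∈ G.flags → Orb G.flags [G.s1, t] a
      (firstIn (G.flags \ flagsOf A) (fun g => G.s1 (G.s2 g)) a) := by
    intro a ha
    by_cases hr : Reaches (G.flags \ flagsOf A) (fun g => G.s1 (G.s2 g)) a
    · refine Reaches.induction (p := fun a => a ∈ G.flags → Orb G.flags [G.s1, t] a
        (firstIn (G.flags \ flagsOf A) (fun g => G.s1 (G.s2 g)) a)) ?_ ?_ hr ha
      · intro a ha _
        rw [firstIn_of_mem ha]
        exact Orb.refl a
      · intro a haK hr ih ha
        rw [firstIn_of_not_mem haK hr]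
        have haA : a ∈ flagsOf A := by
          by_contra h
          exact haK (Finset.mem_sdiff.2 ⟨ha, h⟩)
        have h2 := (hG.1 a ha).2.2
        have h12 := (hG.1 _ h2).2.1
        have hstep : Orb G.flags [G.s1, t] a (G.s2 a) := by
          rw [← hts a ha haA] at h2 ⊢
          exact Orb.of_map (by simp) ha h2
        exact hstep.trans ((Orb.of_map (by simp) h2 h12).trans (ih h12))
    · rw [firstIn_of_not_reaches hr]
      exact Orb.refl a
  refine Orb.lift Orb.equivalence ?_ h
  intro s hs a ha hsa
  rcases List.mem_pair.1 hs with rfl | rfl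
  · have h1 := (hG.1 a (hsub ha)).2.1
    rw [delete_s1 ha]
    exact (Orb.of_map (by simp) (hsub ha) h1).trans (hwalk _ h1)
  · exact Orb.of_map (by simp) (hsub ha) (hsub hsa)

/-- Deleting `e` creates no new component if `s1` acts transitively together with some
map `t` that agrees with `s2` on `e` and with `s0` or `s2` elsewhere. -/
theorem IsRibbon.numK_delete_le (hG : G.IsRibbon) {e : Finset α} (heF : e ⊆ G.flags)
    (hne : e.Nonempty) (he : G.EdgeClosed e) {t : α → α}
    (ht : ∀ a ∈ G.flags, t a = G.s0 a ∨ t a = G.s2 a) (hte : ∀ a ∈ e, t a = G.s2 a)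
    (h : OrbTransitive G.flags [G.s1, t]) (hiso : G.flags ∈ G.isolated → G.flags ⊆ e) :
    (G.delete {e}).numK ≤ G.numK := by
  have heA : flagsOf {e} = e := flagsOf_singleton e
  have heA' : G.EdgeClosed (flagsOf {e}) := heA.symm ▸ he
  have hK := hG.edgeClosed_flags.sdiff heA'
  have hsub : G.flags \ flagsOf {e} ⊆ G.flags := Finset.sdiff_subset
  obtain ⟨x₀, hx₀⟩ := hne.mono heF
  have hcomp : OrbTransitive G.flags [G.s0, G.s1, G.s2] := h.of_step fun s hs a ha hsa => by
    rcases List.mem_pair.1 hs with rfl | rfl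
    · exact Orb.of_map (by simp) ha hsa
    · rcases ht a ha with h | h <;> rw [h] at hsa ⊢ <;> exact Orb.of_map (by simp) ha hsa
  have hcompG : G.compOrbits = {G.flags} := by
    refine Finset.Subset.antisymm hcomp.orbits_subset (Finset.singleton_subset_iff.2 ?_)
    exact mem_orbits.2 ⟨x₀, hx₀, hcomp.orbitOf_eq hx₀⟩
  have hcompD : (G.delete {e}).compOrbits ⊆ {(G.delete {e}).flags} := by
    refine OrbTransitive.orbits_subset ((hG.orbTransitive_delete heA' ht
      (fun a _ ha => hte a (heA ▸ ha)) h).of_step fun s hs a ha hsa => ?_)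
    rcases List.mem_pair.1 hs with rfl | rfl
    · exact Orb.of_map (by simp) ha hsa
    · rcases ht a (hsub ha) with h | h
      · rw [h, ← delete_s0 ha] at hsa ⊢
        exact Orb.of_map (by simp) ha hsa
      · rw [h, ← delete_s2 ha] at hsa ⊢
        exact Orb.of_map (by simp) ha hsa
  have hvert : ∀ v ∈ G.vertexOrbits, v ∩ (G.flags \ flagsOf {e}) = ∅ →
      v = G.flags ∧ G.flags ⊆ e := by
    intro v hv hve
    have hvF := subset_of_mem_orbits hv
    have hve' : v ⊆ e := fun a ha => by
      by_contra hae
      exact Finset.notMem_empty a (hve ▸ Finset.mem_inter.2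
        ⟨ha, Finset.mem_sdiff.2 ⟨hvF ha, heA.symm ▸ hae⟩⟩)
    obtain ⟨x, hx, rfl⟩ := mem_orbits.1 hv
    have hclosed : ∀ s ∈ [G.s1, G.s2], ∀ a ∈ G.flags, s a ∈ G.flags →
        (a ∈ orbitOf G.flags [G.s1, G.s2] x ↔ s a ∈ orbitOf G.flags [G.s1, G.s2] x) := by
      intro s hs a ha hsa
      rw [mem_orbitOf, mem_orbitOf]
      have := Orb.of_map hs ha hsa
      exact ⟨fun h => ⟨hsa, h.2.trans this⟩, fun h => ⟨ha, h.2.trans this.symm⟩⟩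
    have hall : G.flags ⊆ orbitOf G.flags [G.s1, G.s2] x := by
      intro y hy
      refine (Orb.iff_of_step ?_ (h x hx y hy)).1 (self_mem_orbitOf hx)
      intro s hs a ha hsa
      rcases List.mem_pair.1 hs with rfl | rfl
      · exact hclosed _ (by simp) a ha hsa
      · by_cases hae : a ∈ e
        · rw [hte a hae] at hsa ⊢
          exact hclosed _ (by simp) a ha hsa
        · refine iff_of_false (fun h => hae (hve' h)) fun h => hae ?_
          rcases ht a ha with h' | h' <;> rw [h'] at h
          exacts [(he.1 a).1 (hve' h), (he.2 a).1 (hve' h)]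
    exact ⟨hvF.antisymm hall, hall.trans hve'⟩
  have hG' : G.compSet = {G.flags} ∪ G.isolated := by rw [compSet, hcompG]
  have hD : (G.delete {e}).compSet = (G.delete {e}).compOrbits ∪ (G.isolated ∪
      G.vertexOrbits.filter (fun v => v ∩ (G.flags \ flagsOf {e}) = ∅)) := rfl
  unfold numK
  rw [hG', hD]
  by_cases hFe : G.flags ⊆ e
  · have hempty : (G.delete {e}).compOrbits = ∅ := by
      have : (G.delete {e}).flags = ∅ := by
        change G.flags \ flagsOf {e} = ∅
        rw [heA, Finset.sdiff_eq_empty_iff_subset.2 hFe]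
      simp [compOrbits, orbits, this]
    rw [hempty, Finset.empty_union, Finset.union_comm]
    refine Finset.card_le_card (Finset.union_subset_union_left fun v hv => ?_)
    rw [Finset.mem_filter] at hv
    exact Finset.mem_singleton.2 (hvert v hv.1 hv.2).1
  · have hempty : G.vertexOrbits.filter (fun v => v ∩ (G.flags \ flagsOf {e}) = ∅) = ∅ :=
      Finset.filter_eq_empty_iff.2 fun v hv hve => hFe (hvert v hv hve).2
    have hdisj : Disjoint {G.flags} G.isolated :=
      Finset.disjoint_singleton_left.2 fun h => hFe (hiso h)
    rw [hempty, Finset.union_empty, Finset.card_union_of_disjoint hdisj,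
      Finset.card_singleton]
    exact (Finset.card_union_le _ _).trans
      (Nat.add_le_add_right (Finset.card_le_card hcompD) _)

/-- The partial dual with respect to a quasi-tree has a single vertex. -/
theorem IsRibbon.orbTransitive_of_mem_quasiTrees (hG : G.IsRibbon) (hQ : Q ∈ G.quasiTrees) :
    OrbTransitive G.flags [G.s1, (G.partialDual Q).s2] := by
  obtain ⟨hQE, hb⟩ := Finset.mem_filter.1 hQ
  rw [Finset.mem_powerset] at hQE
  have hQc := hG.edgeClosed_flagsOf hQE
  have hCc := hG.edgeClosed_flagsOf (Finset.sdiff_subset (s := G.edgeSet) (t := Q))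
  have hmem : ∀ {x}, x ∈ (G.restrict Q).flags ↔ x ∈ flagsOf Q := mem_flags_restrict hQE
  have hsub : (G.restrict Q).flags ⊆ G.flags := Finset.sdiff_subset
  obtain ⟨O, hO⟩ := Finset.card_eq_one.1 hb
  have hO' : ∀ o ∈ (G.restrict Q).bSet, o = O := fun o ho => by
    rw [hO] at ho
    exact Finset.mem_singleton.1 ho
  have hvert : ∀ v ∈ G.vertexOrbits, v ∩ (G.restrict Q).flags = ∅ → v = O := fun v hv hve =>
    hO' v (Finset.mem_union_right _ (Finset.mem_union_right _ (Finset.mem_filter.2 ⟨hv, hve⟩)))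
  by_cases hne : ∃ q, q ∈ (G.restrict Q).flags
  · obtain ⟨q, hq⟩ := hne
    have horb : ∀ x ∈ (G.restrict Q).flags,
        orbitOf (G.restrict Q).flags [(G.restrict Q).s0, (G.restrict Q).s1] x = O :=
      fun x hx => hO' _ (Finset.mem_union_left _ (orbitOf_mem_orbits hx))
    have hkeep : ∀ x ∈ (G.restrict Q).flags, ∀ y ∈ (G.restrict Q).flags,
        Orb G.flags [G.s1, (G.partialDual Q).s2] x y := by
      intro x hx y hy
      have hxy : Orb (G.restrict Q).flags [(G.restrict Q).s0, (G.restrict Q).s1] x y :=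
        (mem_orbitOf.1 ((horb x hx).trans (horb y hy).symm ▸ self_mem_orbitOf hy)).2
      refine hG.orb_of_orb_delete (A := G.edgeSet \ Q) ?_
        (Orb.lift Orb.equivalence ?_ hxy)
      · intro a _ ha
        rw [hG.partialDual_s2, if_neg ((mem_flagsOf_edgeSet_sdiff hQE).1 ha).2]
      · intro s hs a ha hsa
        rcases List.mem_pair.1 hs with rfl | rfl
        · have hst : (G.restrict Q).s0 a = (G.partialDual Q).s2 a := by
            rw [hG.partialDual_s2, if_pos (hmem.1 ha)]
            exact delete_s0 ha
          rw [hst] at hsa ⊢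
          exact Orb.of_map (by simp) ha hsa
        · exact Orb.of_map List.mem_cons_self ha hsa
    have hreach : ∀ x ∈ G.flags, ∃ y ∈ (G.restrict Q).flags,
        Orb G.flags [G.s1, (G.partialDual Q).s2] x y := by
      intro x hx
      have hv : (orbitOf G.flags [G.s1, G.s2] x ∩ (G.restrict Q).flags).Nonempty := by
        by_contra hv
        rw [Finset.not_nonempty_iff_eq_empty] at hv
        have hqv : q ∈ orbitOf G.flags [G.s1, G.s2] x := by
          rw [hvert _ (orbitOf_mem_orbits hx) hv, ← horb q hq]
          exact self_mem_orbitOf hq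
        exact Finset.notMem_empty q (hv ▸ Finset.mem_inter.2 ⟨hqv, hq⟩)
      obtain ⟨y, hy⟩ := hv
      rw [Finset.mem_inter, mem_orbitOf] at hy
      refine Orb.exists_mem_of_eq_off (hG.edgeClosed_flags.sdiff hCc).2 ?_ hy.1.2 hy.2
      intro a ha haK
      rw [hG.partialDual_s2, if_neg fun h => haK (hmem.2 h)]
    intro x hx y hy
    obtain ⟨x', hx', hxx'⟩ := hreach x hx
    obtain ⟨y', hy', hyy'⟩ := hreach y hy
    exact hxx'.trans ((hkeep x' hx' y' hy').trans hyy'.symm)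
  · have hempty : (G.restrict Q).flags = ∅ :=
      Finset.eq_empty_of_forall_notMem fun q hq => hne ⟨q, hq⟩
    have hv : ∀ x ∈ G.flags, orbitOf G.flags [G.s1, G.s2] x = O := fun x hx =>
      hvert _ (orbitOf_mem_orbits hx) (by rw [hempty, Finset.inter_empty])
    have htrans : OrbTransitive G.flags [G.s1, G.s2] := fun x hx y hy =>
      (mem_orbitOf.1 ((hv x hx).trans (hv y hy).symm ▸ self_mem_orbitOf hy)).2
    refine htrans.of_step fun s hs a ha hsa => ?_
    rcases List.mem_pair.1 hs with rfl | rfl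
    · exact Orb.of_map (by simp) ha hsa
    · have : (G.partialDual Q).s2 a = G.s2 a := by
        rw [hG.partialDual_s2, if_neg fun h => hne ⟨a, hmem.2 h⟩]
      rw [← this] at hsa ⊢
      exact Orb.of_map (by simp) ha hsa

/-- A one-vertex ribbon graph still has one vertex after taking the partial dual with
respect to a non-orientable loop. -/
theorem IsRibbon.orbTransitive_of_isNonorientableLoop (hG : G.IsRibbon)
    (h : OrbTransitive G.flags [G.s1, G.s2]) {e : Finset α} (he : G.IsNonorientableLoop e) :
    OrbTransitive G.flags [G.s1, fun a => if a ∈ e then G.s0 a else G.s2 a] ∧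
      ∀ L ∈ G.isolated, (L ∩ e).Nonempty → L ⊆ e := by
  obtain ⟨⟨heE, -⟩, hb⟩ := he
  have hsE : {e} ⊆ G.edgeSet := Finset.singleton_subset_iff.2 heE
  have heA : flagsOf {e} = e := flagsOf_singleton e
  have hec : G.EdgeClosed e := heA ▸ hG.edgeClosed_flagsOf hsE
  have hmem : ∀ {x}, x ∈ (G.restrict {e}).flags ↔ x ∈ e := fun {x} => by
    rw [mem_flags_restrict hsE, heA]
  obtain ⟨O, hO⟩ := Finset.card_eq_one.1 hb
  have hO' : ∀ o ∈ (G.restrict {e}).bSet, (∃ f ∈ o, f ∈ e) → o = O := fun o ho hoe => by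
    rw [← Finset.mem_singleton, ← hO]
    exact Finset.mem_filter.2 ⟨ho, hoe⟩
  have horb : ∀ x ∈ e,
      orbitOf (G.restrict {e}).flags [(G.restrict {e}).s0, (G.restrict {e}).s1] x = O :=
    fun x hx => hO' _ (Finset.mem_union_left _ (orbitOf_mem_orbits (hmem.2 hx)))
      ⟨x, self_mem_orbitOf (hmem.2 hx), hx⟩
  obtain ⟨x₀, hx₀F, hx₀⟩ := mem_orbits.1 heE
  have hx₀e : x₀ ∈ e := hx₀ ▸ self_mem_orbitOf hx₀F
  constructor
  · have hkeep : ∀ x ∈ e, ∀ y ∈ e,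
        Orb G.flags [G.s1, fun a => if a ∈ e then G.s0 a else G.s2 a] x y := by
      intro x hx y hy
      have hxy : Orb (G.restrict {e}).flags [(G.restrict {e}).s0, (G.restrict {e}).s1] x y :=
        (mem_orbitOf.1 ((horb x hx).trans (horb y hy).symm ▸ self_mem_orbitOf (hmem.2 hy))).2
      refine hG.orb_of_orb_delete (A := G.edgeSet \ {e}) ?_
        (Orb.lift Orb.equivalence ?_ hxy)
      · intro a _ ha
        rw [mem_flagsOf_edgeSet_sdiff hsE, heA] at ha
        exact if_neg ha.2
      · intro s hs a ha hsa
        rcases List.mem_pair.1 hs with rfl | rfl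
        · have hst : (G.restrict {e}).s0 a =
              (fun a => if a ∈ e then G.s0 a else G.s2 a) a :=
            (delete_s0 ha).trans (if_pos (hmem.1 ha)).symm
          rw [hst] at hsa ⊢
          exact Orb.of_map (List.mem_cons_of_mem _ List.mem_cons_self) ha hsa
        · exact Orb.of_map List.mem_cons_self ha hsa
    have hreach : ∀ x ∈ G.flags, ∃ y ∈ e,
        Orb G.flags [G.s1, fun a => if a ∈ e then G.s0 a else G.s2 a] x y := fun x hx =>
      Orb.exists_mem_of_eq_off hec.2 (fun a _ hae => if_neg hae) (h x hx x₀ hx₀F) hx₀e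
    intro x hx y hy
    obtain ⟨x', hx', hxx'⟩ := hreach x hx
    obtain ⟨y', hy', hyy'⟩ := hreach y hy
    exact hxx'.trans ((hkeep x' hx' y' hy').trans hyy'.symm)
  · rintro L hL ⟨f, hf⟩
    rw [Finset.mem_inter] at hf
    have hLO : L = O := hO' L
      (Finset.mem_union_right _ (Finset.mem_union_left _ hL)) ⟨f, hf.1, hf.2⟩
    rw [hLO, ← horb x₀ hx₀e]
    exact fun a ha => hmem.1 (mem_orbitOf.1 ha).1

theorem IsRibbon.contract_eq (hG : G.IsRibbon) (hA : G.EdgeClosed (flagsOf A)) :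
    G.contract A = (G.swap.delete A).swap := by
  rw [contract, hG.dual_eq_swap, (hG.swap.delete hA.swap).dual_eq_swap]

theorem IsRibbon.numK_contract (hG : G.IsRibbon) (hA : G.EdgeClosed (flagsOf A)) :
    (G.contract A).numK = (G.swap.delete A).numK := by
  rw [hG.contract_eq hA, numK_swap]

theorem not_mem_flagsOf {e : Finset α} (he : e ∈ G.edgeSet) (hA : A ⊆ G.edgeSet)
    (heA : e ∉ A) (hx : x ∈ e) : x ∉ flagsOf A := fun h => by
  obtain ⟨e', he', hxe'⟩ := mem_flagsOf.1 h
  rw [← orbitOf_eq_of_mem he hx, orbitOf_eq_of_mem (hA he') hxe'] at heA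
  exact heA he'

/-- Deleting `B` and contracting `A` preserves transitivity of `s1` and `t`, provided `t`
agrees with `s2` on `B` and with `s0` on `A`. -/
theorem IsRibbon.orbTransitive_delete_contract (hG : G.IsRibbon)
    (hB : G.EdgeClosed (flagsOf B)) (hA : G.EdgeClosed (flagsOf A)) {t : α → α}
    (ht : ∀ a ∈ G.flags, t a = G.s0 a ∨ t a = G.s2 a)
    (htB : ∀ a ∈ flagsOf B, t a = G.s2 a) (htA : ∀ a ∈ flagsOf A, t a = G.s0 a)
    (h : OrbTransitive G.flags [G.s1, t]) :
    OrbTransitive ((G.delete B).swap.delete A).flags [((G.delete B).swap.delete A).s1, t] := by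
  refine (hG.delete hB).swap.orbTransitive_delete (hA.delete B).swap ?_ ?_
    (hG.orbTransitive_delete hB ht (fun a _ => htB a) h)
  · intro a ha
    rw [show (G.delete B).swap.s0 a = G.s2 a from delete_s2 ha,
      show (G.delete B).swap.s2 a = G.s0 a from delete_s0 ha]
    exact (ht a (Finset.sdiff_subset ha)).symm
  · intro a ha haA
    rw [show (G.delete B).swap.s2 a = G.s0 a from delete_s0 ha]
    exact htA a haA

theorem mem_isolated_of_mem_delete {L : Finset α} (hL : L ∈ (G.delete A).isolated)
    (hxL : x ∈ L) (hx : x ∈ (G.delete A).flags) : L ∈ G.isolated := by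
  rcases Finset.mem_union.1 hL with h | h
  · exact h
  · exact absurd ((Finset.mem_filter.1 h).2 ▸ Finset.mem_inter.2 ⟨hxL, hx⟩)
      (Finset.notMem_empty x)

end Ribbons

end Ribbon

end QTE

namespace QTE

open Ribbon

/-- Let `𝔾` be a connected ribbon graph with a total order on
`E(𝔾)` and `Q ∈ 𝒬_𝔾`, let `A ⊆ E(Q)` and `B ⊆ E(𝔾)∖E(Q)`, and let `e ∉ A∪B` be
an edge that is non-orientable with respect to `Q`.  Then `e` is neither a
bridge nor a plane loop of the ribbon graph `𝔾∖B/A`. -/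
theorem nonorientable_not_bridge_nor_planeLoop {α : Type} (G : Ribbon α)
    (hG : G.IsRibbon) (hc : G.Connected)
    (lt : Finset α → Finset α → Prop) (hlt : IsStrictTotalOrder (Finset α) lt)
    (Q : Finset (Finset α)) (hQ : Q ∈ G.quasiTrees)
    (A B : Finset (Finset α)) (hA : A ⊆ Q) (hB : B ⊆ G.edgeSet \ Q)
    (e : Finset α) (he : e ∈ G.edgeSet) (heAB : e ∉ A ∪ B)
    (hno : G.NonorientableWrt Q e) :
    ¬ ((G.delete B).contract A).IsBridge e ∧
    ¬ ((G.delete B).contract A).IsPlaneLoop e := by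
  obtain ⟨hQE, -⟩ := Finset.mem_filter.1 hQ
  rw [Finset.mem_powerset] at hQE
  have hAE := hA.trans hQE
  have hBE := hB.trans Finset.sdiff_subset
  obtain ⟨heA, heB⟩ := not_or.1 (fun h => heAB (Finset.mem_union.2 h))
  have hAc := hG.edgeClosed_flagsOf hAE
  have hBc := hG.edgeClosed_flagsOf hBE
  have hQc := hG.edgeClosed_flagsOf hQE
  have hec : G.EdgeClosed e := by
    have := hG.edgeClosed_flagsOf (Finset.singleton_subset_iff.2 he)
    rwa [flagsOf_singleton] at this
  have hxA : ∀ x ∈ e, x ∉ flagsOf A := fun x => not_mem_flagsOf he hAE heA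
  have hxB : ∀ x ∈ e, x ∉ flagsOf B := fun x => not_mem_flagsOf he hBE heB
  have hAQ : ∀ x ∈ flagsOf A, x ∈ flagsOf Q := fun x hx =>
    Finset.biUnion_subset_biUnion_of_subset_left _ hA hx
  have hBQ : ∀ x ∈ flagsOf B, x ∉ flagsOf Q := fun x hx =>
    ((mem_flagsOf_edgeSet_sdiff hQE).1
      (Finset.biUnion_subset_biUnion_of_subset_left _ hB hx)).2
  have hD := hG.delete hBc
  have hM := hD.swap.delete (hAc.delete B).swap
  rw [IsBridge, IsPlaneLoop, hD.contract_eq (hAc.delete B)]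
  set M := (G.delete B).swap.delete A with hMdef
  have heM : e ⊆ M.flags := fun x hx => Finset.mem_sdiff.2
    ⟨Finset.mem_sdiff.2 ⟨subset_of_mem_orbits he hx, hxB x hx⟩, hxA x hx⟩
  have hne : e.Nonempty := by
    obtain ⟨a, ha, rfl⟩ := mem_orbits.1 he
    exact ⟨a, self_mem_orbitOf ha⟩
  have hMG : M.flags ⊆ G.flags := Finset.sdiff_subset.trans Finset.sdiff_subset
  have hMs0 : ∀ a ∈ M.flags, M.s0 a = G.s2 a := fun a ha =>
    (delete_s0 ha).trans (delete_s2 (Finset.sdiff_subset ha))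
  have hMs2 : ∀ a ∈ M.flags, M.s2 a = G.s0 a := fun a ha =>
    (delete_s2 ha).trans (delete_s0 (Finset.sdiff_subset ha))
  have hMe : M.EdgeClosed e := (hec.delete B).swap.delete A
  have htrans := hG.orbTransitive_of_mem_quasiTrees hQ
  obtain ⟨htrans', hiso⟩ :=
    (hG.partialDual hQc).orbTransitive_of_isNonorientableLoop htrans hno
  have hMiso : M.flags ∈ M.isolated → M.flags ⊆ e := by
    intro h
    obtain ⟨x, hx⟩ := hne
    have hxM := heM hx
    exact hiso _ (mem_isolated_of_mem_delete (G := G)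
      (mem_isolated_of_mem_delete (G := (G.delete B).swap) h hxM hxM) hxM
      (Finset.sdiff_subset hxM)) ⟨x, Finset.mem_inter.2 ⟨hxM, hx⟩⟩
  -- On `e`, one of the two available maps is `s0` and the other one is `s2`.
  have hmaps : ∃ t t' : α → α,
      (OrbTransitive M.flags [M.s1, t] ∧ (∀ a ∈ G.flags, t a = G.s0 a ∨ t a = G.s2 a) ∧
        ∀ a ∈ e, t a = G.s2 a) ∧
      (OrbTransitive M.flags [M.s1, t'] ∧ (∀ a ∈ G.flags, t' a = G.s0 a ∨ t' a = G.s2 a) ∧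
        ∀ a ∈ e, t' a = G.s0 a) := by
    have hs2 : ∀ a ∈ G.flags,
        (G.partialDual Q).s2 a = G.s0 a ∨ (G.partialDual Q).s2 a = G.s2 a := fun a _ => by
      rw [hG.partialDual_s2]
      split_ifs <;> simp
    have hs0 : ∀ a ∈ G.flags,
        (G.partialDual Q).s0 a = G.s0 a ∨ (G.partialDual Q).s0 a = G.s2 a := fun a _ => by
      rw [hG.partialDual_s0]
      split_ifs <;> simp
    have hτ := hG.orbTransitive_delete_contract hBc hAc hs2
      (fun a ha => by rw [hG.partialDual_s2, if_neg (hBQ a ha)])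
      (fun a ha => by rw [hG.partialDual_s2, if_pos (hAQ a ha)]) htrans
    have hs' : ∀ a ∈ G.flags,
        (if a ∈ e then (G.partialDual Q).s0 a else (G.partialDual Q).s2 a) = G.s0 a ∨
        (if a ∈ e then (G.partialDual Q).s0 a else (G.partialDual Q).s2 a) = G.s2 a :=
      fun a ha => by split_ifs; exacts [hs0 a ha, hs2 a ha]
    have hτ' := hG.orbTransitive_delete_contract hBc hAc hs'
      (fun a ha => by
        rw [if_neg fun h => hxB a h ha, hG.partialDual_s2, if_neg (hBQ a ha)])
      (fun a ha => by
        rw [if_neg fun h => hxA a h ha, hG.partialDual_s2, if_pos (hAQ a ha)]) htrans'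
    by_cases heQ : e ∈ Q
    · have hx : ∀ a ∈ e, a ∈ flagsOf Q := fun a ha => mem_flagsOf.2 ⟨e, heQ, ha⟩
      refine ⟨_, _, ⟨hτ', hs', fun a ha => ?_⟩, hτ, hs2, fun a ha => ?_⟩
      · rw [if_pos ha, hG.partialDual_s0, if_pos (hx a ha)]
      · rw [hG.partialDual_s2, if_pos (hx a ha)]
    · have hx : ∀ a ∈ e, a ∉ flagsOf Q := fun a => not_mem_flagsOf he hQE heQ
      refine ⟨_, _, ⟨hτ, hs2, fun a ha => ?_⟩, hτ', hs', fun a ha => ?_⟩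
      · rw [hG.partialDual_s2, if_neg (hx a ha)]
      · rw [if_pos ha, hG.partialDual_s0, if_neg (hx a ha)]
  obtain ⟨t, t', ⟨ht, htG, hte⟩, ht', htG', hte'⟩ := hmaps
  constructor
  · rintro ⟨-, h⟩
    refine absurd h (not_lt.2 (hM.swap.numK_delete_le heM hne hMe.swap (t := t) ?_ ?_ ht hMiso))
    · intro a ha
      change t a = M.s2 a ∨ t a = M.s0 a
      rw [hMs0 a ha, hMs2 a ha]
      exact htG a (hMG ha)
    · intro a ha
      exact (hte a ha).trans (hMs0 a (heM ha)).symm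
  · rintro ⟨-, h⟩
    rw [hM.swap.numK_contract ((flagsOf_singleton e).symm ▸ hMe.swap), numK_swap] at h
    refine absurd h (not_lt.2 (hM.numK_delete_le heM hne hMe (t := t') ?_ ?_ ht' hMiso))
    · intro a ha
      rw [hMs0 a ha, hMs2 a ha]
      exact (htG' a (hMG ha)).symm
    · intro a ha
      exact (hte' a ha).trans (hMs2 a (heM ha)).symm

end QTE
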